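/- Let k be an algebraically closed field of characteristic p ≥ 0 and let q be a nonzero ternary quartic form over k. Then q is totally harmonic (H(q) = 0) if and only if there exists an invertible linear change of variables M ∈ GL₃(k) such that q∘M is one of the following: (i) a binary quartic form f(y,z) not involving x with S(f) = 0; (ii) x⁴ + y³z, and p ∈ {2,3}; (iii) x(x²y + z³), and p = 3; (iv) x⁴ + y⁴ + z⁴, and p = 3. -/

import Mathlib

open MvPolynomial

noncomputable section

/-- The classical invariant `S` of a binary quartic form with coefficients `f 0, …, f 4`. -/
def Sinv {R : Type*} [CommRing R] (f : Fin 5 → R) : R :=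
  12 * f 0 * f 4 - 3 * f 1 * f 3 + f 2 ^ 2

/-- The classical invariant `T` of a binary quartic form with coefficients `f 0, …, f 4`. -/
def Tinv {R : Type*} [CommRing R] (f : Fin 5 → R) : R :=
  72 * f 0 * f 2 * f 4 - 27 * f 0 * f 3 ^ 2 - 27 * f 1 ^ 2 * f 4
    + 9 * f 1 * f 2 * f 3 - 2 * f 2 ^ 3

/-- The binary quartic form `f₀ y⁴ + f₁ y³z + f₂ y²z² + f₃ yz³ + f₄ z⁴`. -/
def binQuartic {R : Type*} [CommRing R] (f : Fin 5 → R) : MvPolynomial (Fin 2) R :=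
  ∑ i : Fin 5, C (f i) * X 0 ^ (4 - (i : ℕ)) * X 1 ^ (i : ℕ)

/-- The `i`-th coefficient of a binary quartic form: coefficient of `y^(4-i) z^i`. -/
def binCoeff {R : Type*} [CommRing R] (g : MvPolynomial (Fin 2) R) (i : Fin 5) : R :=
  coeff (Finsupp.single 0 (4 - (i : ℕ)) + Finsupp.single 1 (i : ℕ)) g

/-- The substitution `g(y,z) = q(-v·y - w·z, u·y, u·z)`, a binary quartic form in `y, z` with
coefficients in `R[u,v,w]`. -/
def gsub {R : Type*} [CommRing R] (q : MvPolynomial (Fin 3) R) :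
    MvPolynomial (Fin 2) (MvPolynomial (Fin 3) R) :=
  aeval
    (![(C (- X 1) * X 0 - C (X 2) * X 1 : MvPolynomial (Fin 2) (MvPolynomial (Fin 3) R)),
       C (X 0) * X 0, C (X 0) * X 1]) q

/-- `u⁴ · H(q)`, the invariant `S` of `g(y,z) = q(-vy-wz, uy, uz)`; the harmonic quartic `H(q)`
is the form determined by `u⁴ · H(q) = SG q`. -/
def SG {R : Type*} [CommRing R] (q : MvPolynomial (Fin 3) R) : MvPolynomial (Fin 3) R :=
  Sinv (fun i => binCoeff (gsub q) i)

/-- `u⁶ · K(q)`, the invariant `T` of `g(y,z) = q(-vy-wz, uy, uz)`; the harmonic sextic `K(q)`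
is the form determined by `u⁶ · K(q) = TG q`. -/
def TG {R : Type*} [CommRing R] (q : MvPolynomial (Fin 3) R) : MvPolynomial (Fin 3) R :=
  Tinv (fun i => binCoeff (gsub q) i)

/-- dot product of two vectors in `R³`. -/
def dot3 {R : Type*} [CommRing R] (d a : Fin 3 → R) : R :=
  d 0 * a 0 + d 1 * a 1 + d 2 * a 2

/-- restriction of a ternary form to the parameterized line `(y,z) ↦ y·a + z·b`. -/
def restrictLine {R : Type*} [CommRing R] (q : MvPolynomial (Fin 3) R) (a b : Fin 3 → R) :
    MvPolynomial (Fin 2) R :=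
  aeval (fun i => C (a i) * X 0 + C (b i) * X 1) q

/-- A binary quartic form vanishes identically or has a root of multiplicity at least `3`:
`f = L³·M` with `L ≠ 0` linear and `M` linear (possibly zero). -/
def HasTripleRoot {R : Type*} [CommRing R] (f : MvPolynomial (Fin 2) R) : Prop :=
  ∃ L M : MvPolynomial (Fin 2) R,
    L.IsHomogeneous 1 ∧ M.IsHomogeneous 1 ∧ L ≠ 0 ∧ f = L ^ 3 * M

/-- The line with dual coordinates `d` is an inflection line of the quartic `{q = 0}`. -/
def IsInflectionLine {k : Type*} [Field k] (q : MvPolynomial (Fin 3) k) (d : Fin 3 → k) :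
    Prop :=
  d ≠ 0 ∧ ∃ a b : Fin 3 → k, LinearIndependent k ![a, b] ∧
    dot3 d a = 0 ∧ dot3 d b = 0 ∧ HasTripleRoot (restrictLine q a b)

/-- The line with dual coordinates `d` is a simple inflection line of `{q = 0}` with
inflection point `p`. -/
def IsSimpleInflectionLineAt {k : Type*} [Field k] (q : MvPolynomial (Fin 3) k)
    (d p : Fin 3 → k) : Prop :=
  d ≠ 0 ∧ ∃ (a b : Fin 3 → k) (s t : k), LinearIndependent k ![a, b] ∧
    dot3 d a = 0 ∧ dot3 d b = 0 ∧ (s, t) ≠ (0, 0) ∧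
    (∀ i, p i = s * a i + t * b i) ∧
    eval p q = 0 ∧ (∃ i, eval p (pderiv i q) ≠ 0) ∧
    ∃ L M : MvPolynomial (Fin 2) k, L.IsHomogeneous 1 ∧ M.IsHomogeneous 1 ∧
      LinearIndependent k ![L, M] ∧
      restrictLine q a b = L ^ 3 * M ∧ eval ![s, t] L = 0

/-- The line with dual coordinates `d` is a hyperinflection line of `{q = 0}` with
hyperinflection point `p`. -/
def IsHyperinflectionLineAt {k : Type*} [Field k] (q : MvPolynomial (Fin 3) k)
    (d p : Fin 3 → k) : Prop :=
  d ≠ 0 ∧ ∃ (a b : Fin 3 → k) (s t : k), LinearIndependent k ![a, b] ∧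
    dot3 d a = 0 ∧ dot3 d b = 0 ∧ (s, t) ≠ (0, 0) ∧
    (∀ i, p i = s * a i + t * b i) ∧
    eval p q = 0 ∧ (∃ i, eval p (pderiv i q) ≠ 0) ∧
    ∃ (c : k) (L : MvPolynomial (Fin 2) k), c ≠ 0 ∧ L.IsHomogeneous 1 ∧ L ≠ 0 ∧
      restrictLine q a b = C c * L ^ 4 ∧ eval ![s, t] L = 0

/-- The pairing `⟨·,·⟩` between quartic forms in `x,y,z` and quartic forms in `u,v,w`:
`⟨x^i y^j z^k, u^i v^j w^k⟩ = i!j!k!/2`. -/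
def pairQ {R : Type*} [CommRing R] (q h : MvPolynomial (Fin 3) R) : R :=
  ∑ m ∈ q.support,
    (((m 0).factorial * (m 1).factorial * (m 2).factorial / 2 : ℕ) : R)
      * coeff m q * coeff m h

/-- The action of `Σ c_{ξη} ξ ∂_η ∈ 𝔤𝔩₃(R)` on polynomials. -/
def lieAct {R : Type*} [CommRing R] (c : Fin 3 → Fin 3 → R)
    (q : MvPolynomial (Fin 3) R) : MvPolynomial (Fin 3) R :=
  ∑ ξ : Fin 3, ∑ η : Fin 3, C (c ξ η) * (X ξ * pderiv η q)

/-- substitution of variables by the linear change of coordinates `M`: `q(M·(x,y,z)ᵗ)`. -/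
def substM {R : Type*} [CommRing R] (M : Matrix (Fin 3) (Fin 3) R)
    (q : MvPolynomial (Fin 3) R) : MvPolynomial (Fin 3) R :=
  aeval (fun i => ∑ j : Fin 3, C (M i j) * X j) q

/-- The quartic form `q_ε = (x−y)⁴ + (x−z)⁴ + (y−εz)⁴ − (x⁴ + y⁴ + z⁴)`. -/
def qeps {k : Type*} [CommRing k] (ε : k) : MvPolynomial (Fin 3) k :=
  (X 0 - X 1) ^ 4 + (X 0 - X 2) ^ 4 + (X 1 - C ε * X 2) ^ 4
    - (X 0 ^ 4 + X 1 ^ 4 + X 2 ^ 4)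


section StmtFive

def bq {R : Type*} [CommRing R] (f : Fin 5 → R) (s t : R) : R :=
  f 0 * s ^ 4 + f 1 * s ^ 3 * t + f 2 * s ^ 2 * t ^ 2 + f 3 * s * t ^ 3 + f 4 * t ^ 4

lemma homog_expand {R : Type*} [CommRing R] {n d : ℕ} (q : MvPolynomial (Fin n) R)
    (hq : q.IsHomogeneous d) :
    q = ∑ t ∈ Finset.Nat.antidiagonalTuple n d,
      monomial (Finsupp.equivFunOnFinite.symm t) (coeff (Finsupp.equivFunOnFinite.symm t) q) := by
  ext m
  rw [coeff_sum]
  simp only [coeff_monomial]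
  have h : ∀ t : Fin n → ℕ, (Finsupp.equivFunOnFinite.symm t = m) ↔ t = m := by
    intro t
    constructor
    · rintro rfl; rfl
    · intro h; ext i; simp [h]
  simp only [h]
  rw [Finset.sum_ite_eq' (Finset.Nat.antidiagonalTuple n d) (⇑m)]
  split_ifs with hm
  · congr 1
    ext i; simp
  · by_contra hc
    apply hm
    have := hq hc
    rw [Finset.Nat.mem_antidiagonalTuple]
    rw [← this]
    rw [Finsupp.weight_apply, Finsupp.sum_fintype]
    · simp
    · simp

lemma bin_rep {R S : Type*} [CommRing R] [CommRing S] (φ : R →+* S) (g : MvPolynomial (Fin 2) R)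
    (hg : g.IsHomogeneous 4) (s t : S) :
    eval₂ φ ![s, t] g = bq (fun i => φ (binCoeff g i)) s t := by
  have h : ∀ i : Fin 5, binCoeff g i =
      coeff (Finsupp.equivFunOnFinite.symm ![4 - (i : ℕ), (i : ℕ)]) g := by
    intro i
    unfold binCoeff
    congr 1
    ext j
    fin_cases j <;> simp
  simp only [bq, h]
  conv_lhs => rw [homog_expand g hg]
  have hs : Finset.Nat.antidiagonalTuple 2 4 =
    {![4, 0], ![3, 1], ![2, 2], ![1, 3], ![0, 4]} := by decide
  rw [hs, eval₂_sum]
  simp only [eval₂_monomial]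
  rw [Finset.sum_insert (by decide), Finset.sum_insert (by decide), Finset.sum_insert (by decide),
    Finset.sum_insert (by decide), Finset.sum_singleton]
  simp [Finsupp.prod_fintype, Fin.prod_univ_two]
  ring

def ev {R : Type*} [CommRing R] (c : Fin 15 → R) (x y z : R) : R :=
  c 0 * x ^ 4 + x ^ 3 * (c 1 * y + c 2 * z) + x ^ 2 * (c 3 * y ^ 2 + c 4 * y * z + c 5 * z ^ 2)
  + x * (c 6 * y ^ 3 + c 7 * y ^ 2 * z + c 8 * y * z ^ 2 + c 9 * z ^ 3)
  + (c 10 * y ^ 4 + c 11 * y ^ 3 * z + c 12 * y ^ 2 * z ^ 2 + c 13 * y * z ^ 3 + c 14 * z ^ 4)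

lemma tern_rep {R : Type*} [CommRing R] (q : MvPolynomial (Fin 3) R) (hq : q.IsHomogeneous 4) :
    ∃ c : Fin 15 → R, ∀ x y z, eval ![x, y, z] q = ev c x y z := by
  let e : ℕ → ℕ → ℕ → R := fun a b c => coeff (Finsupp.equivFunOnFinite.symm ![a, b, c]) q
  refine ⟨![e 4 0 0, e 3 1 0, e 3 0 1, e 2 2 0, e 2 1 1, e 2 0 2, e 1 3 0, e 1 2 1, e 1 1 2,
    e 1 0 3, e 0 4 0, e 0 3 1, e 0 2 2, e 0 1 3, e 0 0 4], ?_⟩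
  intro x y z
  conv_lhs => rw [homog_expand q hq]
  have hs : Finset.Nat.antidiagonalTuple 3 4 =
    {![4, 0, 0], ![3, 1, 0], ![3, 0, 1], ![2, 2, 0], ![2, 1, 1], ![2, 0, 2], ![1, 3, 0],
     ![1, 2, 1], ![1, 1, 2], ![1, 0, 3], ![0, 4, 0], ![0, 3, 1], ![0, 2, 2], ![0, 1, 3],
     ![0, 0, 4]} := by decide
  rw [hs, map_sum]
  simp only [eval_monomial]
  iterate 14 rw [Finset.sum_insert (by decide)]
  rw [Finset.sum_singleton]
  simp [Finsupp.prod_fintype, Fin.prod_univ_three, ev, e]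
  ring

lemma bq_inj {R : Type*} [CommRing R] [IsDomain R] [Infinite R] {f g : Fin 5 → R}
    (h : ∀ s t, bq f s t = bq g s t) : f = g := by
  have h1 : (Polynomial.C (f 0) * Polynomial.X ^ 4 + Polynomial.C (f 1) * Polynomial.X ^ 3
      + Polynomial.C (f 2) * Polynomial.X ^ 2 + Polynomial.C (f 3) * Polynomial.X
      + Polynomial.C (f 4) : Polynomial R) =
      Polynomial.C (g 0) * Polynomial.X ^ 4 + Polynomial.C (g 1) * Polynomial.X ^ 3
      + Polynomial.C (g 2) * Polynomial.X ^ 2 + Polynomial.C (g 3) * Polynomial.X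
      + Polynomial.C (g 4) := by
    apply Polynomial.funext
    intro r
    have := h r 1
    simp [bq] at this
    simp [this]
  funext i
  have h2 := congrArg (fun p => Polynomial.coeff p (4 - (i : ℕ))) h1
  fin_cases i <;> simpa [Polynomial.coeff_X, Polynomial.coeff_C] using h2

def bqsub {R : Type*} [CommRing R] (f : Fin 5 → R) (α β γ δ : R) : Fin 5 → R :=
  ![bq f α γ,
    4 * f 0 * α ^ 3 * β + f 1 * (3 * α ^ 2 * β * γ + α ^ 3 * δ)
      + f 2 * (2 * α * β * γ ^ 2 + 2 * α ^ 2 * γ * δ)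
      + f 3 * (β * γ ^ 3 + 3 * α * γ ^ 2 * δ) + 4 * f 4 * γ ^ 3 * δ,
    6 * f 0 * α ^ 2 * β ^ 2 + f 1 * (3 * α * β ^ 2 * γ + 3 * α ^ 2 * β * δ)
      + f 2 * (β ^ 2 * γ ^ 2 + 4 * α * β * γ * δ + α ^ 2 * δ ^ 2)
      + f 3 * (3 * β * γ ^ 2 * δ + 3 * α * γ * δ ^ 2) + 6 * f 4 * γ ^ 2 * δ ^ 2,
    4 * f 0 * α * β ^ 3 + f 1 * (β ^ 3 * γ + 3 * α * β ^ 2 * δ)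
      + f 2 * (2 * β ^ 2 * γ * δ + 2 * α * β * δ ^ 2)
      + f 3 * (3 * β * γ * δ ^ 2 + α * δ ^ 3) + 4 * f 4 * γ * δ ^ 3,
    bq f β δ]

lemma bq_bqsub {R : Type*} [CommRing R] (f : Fin 5 → R) (α β γ δ s t : R) :
    bq f (α * s + β * t) (γ * s + δ * t) = bq (bqsub f α β γ δ) s t := by
  simp [bq, bqsub]
  ring

lemma Sinv_bqsub {R : Type*} [CommRing R] (f : Fin 5 → R) (α β γ δ : R) :
    Sinv (bqsub f α β γ δ) = (α * δ - β * γ) ^ 4 * Sinv f := by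
  simp [Sinv, bq, bqsub]
  ring

lemma gsub_homog {R : Type*} [CommRing R] (q : MvPolynomial (Fin 3) R) (hq : q.IsHomogeneous 4) :
    (gsub q).IsHomogeneous 4 := by
  have := hq.aeval (S := MvPolynomial (Fin 3) R)
    ![(C (- X 1) * X 0 - C (X 2) * X 1 : MvPolynomial (Fin 2) (MvPolynomial (Fin 3) R)),
       C (X 0) * X 0, C (X 0) * X 1] (n := 1) (by
      intro i
      fin_cases i
      · exact ((isHomogeneous_X _ _).C_mul _).sub ((isHomogeneous_X _ _).C_mul _)
      · exact ((isHomogeneous_X _ _).C_mul _)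
      · exact ((isHomogeneous_X _ _).C_mul _))
  simpa [gsub] using this

lemma eval2_aeval {k R S : Type*} [CommRing k] [CommRing R] [CommRing S] [Algebra k R] [Algebra k S]
    {n m : ℕ} (φ : R →ₐ[k] S) (v : Fin m → S) (w : Fin n → MvPolynomial (Fin m) R)
    (q : MvPolynomial (Fin n) k) :
    eval₂ (φ : R →+* S) v (aeval w q) = aeval (fun i => eval₂ (φ : R →+* S) v (w i)) q := by
  induction q using MvPolynomial.induction_on with
  | C r =>
    rw [aeval_C, aeval_C, MvPolynomial.algebraMap_apply, eval₂_C]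
    simp
  | add p q hp hq => simp only [map_add, eval₂_add, hp, hq]
  | mul_X p i hp => simp only [map_mul, eval₂_mul, hp, aeval_X]

lemma restr_rep {k R : Type*} [CommRing k] [CommRing R] [Algebra k R] (q : MvPolynomial (Fin 3) k)
    (hq : q.IsHomogeneous 4) (a b : Fin 3 → R) :
    ∃ f : Fin 5 → R, ∀ s t, aeval (fun i => s * a i + t * b i) q = bq f s t := by
  have := hq.aeval (S := R) (fun i => C (a i) * X 0 + C (b i) * X 1 : Fin 3 → MvPolynomial (Fin 2) R)
    (n := 1) (fun i => ((isHomogeneous_X _ _).C_mul _).add ((isHomogeneous_X _ _).C_mul _))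
  rw [one_mul] at this
  refine ⟨fun i => (AlgHom.id k R : R →+* R) (binCoeff
    (aeval (fun i => C (a i) * X 0 + C (b i) * X 1 : Fin 3 → MvPolynomial (Fin 2) R) q) i), fun s t => ?_⟩
  rw [← bin_rep _ _ this, eval2_aeval]
  congr 2
  funext i
  simp [mul_comm]

lemma SG_eval {k R : Type*} [CommRing k] [CommRing R] [Algebra k R] (q : MvPolynomial (Fin 3) k)
    (hq : q.IsHomogeneous 4) (w : Fin 3 → R) :
    ∃ f : Fin 5 → R, aeval w (SG q) = Sinv f ∧
      ∀ s t, aeval ![-w 1 * s - w 2 * t, w 0 * s, w 0 * t] q = bq f s t := by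
  refine ⟨fun i => aeval w (binCoeff (gsub q) i), ?_, ?_⟩
  · simp [SG, Sinv]
  · intro s t
    have := bin_rep ((aeval w : MvPolynomial (Fin 3) k →ₐ[k] R) : MvPolynomial (Fin 3) k →+* R)
      (gsub q) (gsub_homog q hq) s t
    rw [show (fun i => aeval w (binCoeff (gsub q) i)) = fun i =>
      ((aeval w : MvPolynomial (Fin 3) k →ₐ[k] R) : MvPolynomial (Fin 3) k →+* R)
        (binCoeff (gsub q) i) from rfl, ← this]
    rw [gsub, eval2_aeval]
    congr 2
    funext i
    fin_cases i <;> simp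

def Pq {k : Type*} [CommRing k] (F : k → k → k → k) : Prop :=
  ∀ (a b : Fin 3 → k) (f : Fin 5 → k),
    (∀ s t, F (s * a 0 + t * b 0) (s * a 1 + t * b 1) (s * a 2 + t * b 2) = bq f s t) → Sinv f = 0

lemma vec3_eta {R : Type*} (v : Fin 3 → R) : ![v 0, v 1, v 2] = v := by
  funext i; fin_cases i <;> rfl

lemma SG_dom {k R : Type*} [CommRing k] [CommRing R] [Algebra k R] [IsDomain R] [Infinite R]
    (q : MvPolynomial (Fin 3) k)
    (hq : q.IsHomogeneous 4) (h : SG q = 0) (a b : Fin 3 → R) (f : Fin 5 → R)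
    (hf : ∀ s t, aeval (fun i => s * a i + t * b i) q = bq f s t)
    (hu : a 1 * b 2 - a 2 * b 1 ≠ 0) : Sinv f = 0 := by
  obtain ⟨g, hg, hg'⟩ := SG_eval q hq ![a 1 * b 2 - a 2 * b 1, a 2 * b 0 - a 0 * b 2,
    a 0 * b 1 - a 1 * b 0]
  rw [h, map_zero] at hg
  have key : g = bqsub f (b 2) (-b 1) (-a 2) (a 1) := by
    apply bq_inj
    intro s t
    rw [← hg']
    have := hf (b 2 * s - b 1 * t) (-a 2 * s + a 1 * t)
    have e : (fun i => (b 2 * s - b 1 * t) * a i + (-a 2 * s + a 1 * t) * b i) =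
      ![-(a 2 * b 0 - a 0 * b 2) * s - (a 0 * b 1 - a 1 * b 0) * t,
        (a 1 * b 2 - a 2 * b 1) * s, (a 1 * b 2 - a 2 * b 1) * t] := by
      funext i
      fin_cases i <;> simp <;> ring
    rw [e] at this
    simp only [Matrix.cons_val_zero, Matrix.cons_val_one, Matrix.cons_val]
    rw [this, ← bq_bqsub]
    congr 1
    ring
  have : Sinv g = (a 1 * b 2 - a 2 * b 1) ^ 4 * Sinv f := by
    rw [key, Sinv_bqsub]
    ring
  rw [← hg] at this
  exact (mul_eq_zero.mp this.symm).resolve_left (pow_ne_zero _ hu)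

lemma P_of_SG {k : Type*} [Field k] [Infinite k] (q : MvPolynomial (Fin 3) k)
    (hq : q.IsHomogeneous 4) (h : SG q = 0) : Pq (fun x y z => eval ![x, y, z] q) := by
  intro a b f hf
  let A : Fin 3 → Polynomial k := ![Polynomial.C (a 0), Polynomial.C (a 1) + Polynomial.X,
    Polynomial.C (a 2)]
  let B : Fin 3 → Polynomial k := ![Polynomial.C (b 0), Polynomial.C (b 1),
    Polynomial.C (b 2) + Polynomial.X]
  obtain ⟨g, hg⟩ := restr_rep q hq A B
  have h0 : Sinv g = 0 := by
    apply SG_dom q hq h A B g hg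
    intro hc
    have := congrArg (fun p => Polynomial.coeff p 2) hc
    have e : A 1 * B 2 - A 2 * B 1 = Polynomial.X ^ 2 + (Polynomial.C (a 1 + b 2)) * Polynomial.X
      + Polynomial.C (a 1 * b 2 - a 2 * b 1) := by
      simp [A, B]
      ring
    rw [e] at this
    simp at this
  have h1 : f = fun i => Polynomial.eval 0 (g i) := by
    apply bq_inj
    intro s t
    rw [← hf]
    have := congrArg (Polynomial.aeval (0 : k)) (hg (Polynomial.C s) (Polynomial.C t))
    rw [comp_aeval_apply] at this
    simp only [bq] at this ⊢
    simp at this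
    rw [← this]
    congr 2
    funext i
    fin_cases i <;> simp [A, B]
  rw [h1]
  have := congrArg (Polynomial.eval 0) h0
  simpa [Sinv] using this

lemma SG_of_P {k : Type*} [Field k] [Infinite k] (q : MvPolynomial (Fin 3) k)
    (hq : q.IsHomogeneous 4) (h : Pq (fun x y z => eval ![x, y, z] q)) : SG q = 0 := by
  apply MvPolynomial.funext
  intro w
  obtain ⟨f, hf, hf'⟩ := SG_eval q hq w
  rw [map_zero, ← coe_aeval_eq_eval, RingHom.coe_coe, hf]
  apply h ![-w 1, w 0, 0] ![-w 2, 0, w 0]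
  intro s t
  dsimp only
  rw [← hf', ← coe_aeval_eq_eval, RingHom.coe_coe]
  congr 2
  funext i
  fin_cases i <;> simp <;> ring

variable {k : Type*} [Field k]

def act (M : Matrix (Fin 3) (Fin 3) k) (F : k → k → k → k) : k → k → k → k :=
  fun x y z => F (M 0 0 * x + M 0 1 * y + M 0 2 * z) (M 1 0 * x + M 1 1 * y + M 1 2 * z)
    (M 2 0 * x + M 2 1 * y + M 2 2 * z)

lemma act_act (M N : Matrix (Fin 3) (Fin 3) k) (F : k → k → k → k) :
    act N (act M F) = act (M * N) F := by
  funext x y z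
  simp only [act, Matrix.mul_apply, Fin.sum_univ_three]
  congr 1 <;> ring

lemma act_one (F : k → k → k → k) : act 1 F = F := by
  funext x y z
  simp [act]

def Good (p : ℕ) (F : k → k → k → k) : Prop :=
  ∃ M : Matrix (Fin 3) (Fin 3) k, M.det ≠ 0 ∧
    ((∃ f : Fin 5 → k, Sinv f = 0 ∧ ∀ x y z, act M F x y z = bq f y z) ∨
     ((∀ x y z, act M F x y z = x ^ 4 + y ^ 3 * z) ∧ (p = 2 ∨ p = 3)) ∨
     ((∀ x y z, act M F x y z = x * (x ^ 2 * y + z ^ 3)) ∧ p = 3) ∨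
     ((∀ x y z, act M F x y z = x ^ 4 + y ^ 4 + z ^ 4) ∧ p = 3))

lemma good_act {p : ℕ} {F : k → k → k → k} (M : Matrix (Fin 3) (Fin 3) k) (hM : M.det ≠ 0)
    (h : Good p (act M F)) : Good p F := by
  obtain ⟨N, hN, h⟩ := h
  refine ⟨M * N, by rw [Matrix.det_mul]; exact mul_ne_zero hM hN, ?_⟩
  rwa [act_act] at h

lemma Pq_act {F : k → k → k → k} (M : Matrix (Fin 3) (Fin 3) k) (h : Pq F) : Pq (act M F) := by
  intro a b f hf
  apply h (fun i => M i 0 * a 0 + M i 1 * a 1 + M i 2 * a 2)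
    (fun i => M i 0 * b 0 + M i 1 * b 1 + M i 2 * b 2)
  intro s t
  rw [← hf, act]
  congr 1 <;> ring

lemma Pq_of_act {F : k → k → k → k} (M : Matrix (Fin 3) (Fin 3) k) (hM : M.det ≠ 0)
    (h : Pq (act M F)) : Pq F := by
  have := Pq_act M⁻¹ h
  rwa [act_act, Matrix.mul_nonsing_inv _ (isUnit_iff_ne_zero.mpr hM), act_one] at this

def IsQ (F : k → k → k → k) : Prop :=
  ∃ q : MvPolynomial (Fin 3) k, q.IsHomogeneous 4 ∧ F = fun x y z => eval ![x, y, z] q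

lemma eval_substM (M : Matrix (Fin 3) (Fin 3) k) (q : MvPolynomial (Fin 3) k) (x y z : k) :
    eval ![x, y, z] (substM M q) = act M (fun x y z => eval ![x, y, z] q) x y z := by
  have := eval2_aeval (AlgHom.id k k) ![x, y, z] (fun i => ∑ j : Fin 3, C (M i j) * X j) q
  simp only [act]
  rw [substM]
  refine Eq.trans ?_ (this.trans ?_)
  · rfl
  · rw [← RingHom.coe_coe, coe_aeval_eq_eval]
    congr 2
    funext i
    fin_cases i <;> simp [Fin.sum_univ_three]

lemma IsQ_act {F : k → k → k → k} (M : Matrix (Fin 3) (Fin 3) k) (h : IsQ F) : IsQ (act M F) := by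
  obtain ⟨q, hq, rfl⟩ := h
  refine ⟨substM M q, ?_, ?_⟩
  · have := hq.aeval (S := k) (fun i => ∑ j : Fin 3, C (M i j) * X j) (n := 1)
      (fun i => IsHomogeneous.sum _ _ _ fun j _ => (isHomogeneous_X _ _).C_mul _)
    simpa [substM] using this
  · funext x y z
    rw [eval_substM]

lemma IsQ_ev {F : k → k → k → k} (h : IsQ F) : ∃ c, F = ev c := by
  obtain ⟨q, hq, rfl⟩ := h
  obtain ⟨c, hc⟩ := tern_rep q hq
  exact ⟨c, by funext x y z; exact hc x y z⟩

lemma ev_line (c : Fin 15 → k) (y z s t : k) : ev c s (t * y) (t * z) =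
    bq ![c 0, c 1 * y + c 2 * z, c 3 * y ^ 2 + c 4 * y * z + c 5 * z ^ 2,
      c 6 * y ^ 3 + c 7 * y ^ 2 * z + c 8 * y * z ^ 2 + c 9 * z ^ 3,
      c 10 * y ^ 4 + c 11 * y ^ 3 * z + c 12 * y ^ 2 * z ^ 2 + c 13 * y * z ^ 3 + c 14 * z ^ 4]
      s t := by
  simp [ev, bq]
  ring

lemma Pq_line {c : Fin 15 → k} (h : Pq (ev c)) (y z : k) :
    12 * c 0 * (c 10 * y ^ 4 + c 11 * y ^ 3 * z + c 12 * y ^ 2 * z ^ 2 + c 13 * y * z ^ 3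
      + c 14 * z ^ 4) - 3 * (c 1 * y + c 2 * z) *
      (c 6 * y ^ 3 + c 7 * y ^ 2 * z + c 8 * y * z ^ 2 + c 9 * z ^ 3)
      + (c 3 * y ^ 2 + c 4 * y * z + c 5 * z ^ 2) ^ 2 = 0 := by
  have := h ![1, 0, 0] ![0, y, z] _ (fun s t => by
    have := ev_line c y z s t
    simpa using this)
  simpa [Sinv] using this

/-- first-order data at `e₀` -/
lemma first_order [Infinite k] {F : k → k → k → k} {c : Fin 15 → k} (hF : F = ev c) {y z : k}
    {f : Fin 5 → k} (h : ∀ s t, F s (t * y) (t * z) = bq f s t) :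
    c 0 = f 0 ∧ c 1 * y + c 2 * z = f 1 := by
  have e := bq_inj (fun s t => (h s t).symm.trans (by rw [hF]; exact ev_line c y z s t))
  exact ⟨(congrFun e 0).symm, (congrFun e 1).symm⟩

lemma normL [Infinite k] {p : ℕ} (H : ∀ c : Fin 15 → k, IsQ (ev c) → Pq (ev c) → c 0 = 0 →
    c 1 = 0 → c 2 = 1 → Good p (ev c)) (c : Fin 15 → k) (hQ : IsQ (ev c)) (hP : Pq (ev c))
    (h0 : c 0 = 0) (h12 : c 1 ≠ 0 ∨ c 2 ≠ 0) : Good p (ev c) := by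
  have key : ∀ M : Matrix (Fin 3) (Fin 3) k, M.det ≠ 0 → M 0 0 = 1 → M 0 1 = 0 → M 0 2 = 0 →
      M 1 0 = 0 → M 2 0 = 0 → c 1 * M 1 1 + c 2 * M 2 1 = 0 → c 1 * M 1 2 + c 2 * M 2 2 = 1 →
      Good p (ev c) := by
    intro M hM h00 h01 h02 h10 h20 e1 e2
    apply good_act M hM
    obtain ⟨c', hc'⟩ := IsQ_ev (IsQ_act M hQ)
    have fo : ∀ y z, c' 0 = 0 ∧ c' 1 * y + c' 2 * z = z := by
      intro y z
      have := first_order hc' (y := y) (z := z) (fun s t => by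
        rw [act, h00, h01, h02, h10, h20,
          show (1 * s + 0 * (t * y) + 0 * (t * z)) = s by ring,
          show 0 * s + M 1 1 * (t * y) + M 1 2 * (t * z) = t * (M 1 1 * y + M 1 2 * z) by ring,
          show 0 * s + M 2 1 * (t * y) + M 2 2 * (t * z) = t * (M 2 1 * y + M 2 2 * z) by ring,
          ev_line])
      simp only [Matrix.cons_val_zero, Matrix.cons_val_one] at this
      refine ⟨this.1.trans h0, this.2.trans ?_⟩
      linear_combination y * e1 + z * e2
    rw [hc']
    apply H
    · rw [← hc']; exact IsQ_act M hQ
    · rw [← hc']; exact Pq_act M hP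
    · exact (fo 0 0).1
    · simpa using (fo 1 0).2
    · simpa using (fo 0 1).2
  by_cases h2 : c 2 = 0
  · have h1 : c 1 ≠ 0 := by tauto
    apply key !![1, 0, 0; 0, 0, (c 1)⁻¹; 0, 1, 0] <;> simp [Matrix.det_fin_three, h1, h2]
  · apply key !![1, 0, 0; 0, 1, 0; 0, -c 1 * (c 2)⁻¹, (c 2)⁻¹] <;>
      simp [Matrix.det_fin_three, h2]
    field_simp
    ring

lemma char2 {p : ℕ} [CharP k p] (h : (2 : k) = 0) : p = 2 := by
  have : ((2 : ℕ) : k) = 0 := by exact_mod_cast h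
  rw [CharP.cast_eq_zero_iff k p] at this
  exact ((Nat.dvd_prime Nat.prime_two).mp this).resolve_left (CharP.char_ne_one k p)

lemma char3 {p : ℕ} [CharP k p] (h : (3 : k) = 0) : p = 3 := by
  have : ((3 : ℕ) : k) = 0 := by exact_mod_cast h
  rw [CharP.cast_eq_zero_iff k p] at this
  exact ((Nat.dvd_prime Nat.prime_three).mp this).resolve_left (CharP.char_ne_one k p)

lemma exists_root4 [IsAlgClosed k] (d : k) : ∃ r, r ^ 4 = d :=
  IsAlgClosed.exists_pow_nat_eq d (by norm_num)

lemma finish13 [IsAlgClosed k] {p : ℕ} [CharP k p] (h3 : (3 : k) ≠ 0) (F : k → k → k → k)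
    (d : Fin 5 → k)
    (hF : ∀ x y z, F x y z = x ^ 3 * z + bq d y z) (hP : Pq F) : Good p F := by
  have hS : ∀ α β : k, Sinv ![d 0, d 1 + α ^ 3, d 2 + 3 * α ^ 2 * β, d 3 + 3 * α * β ^ 2,
      d 4 + β ^ 3] = 0 := by
    intro α β
    apply hP ![α, 1, 0] ![β, 0, 1]
    intro s t
    rw [hF]
    simp [bq]
    ring
  simp [Sinv] at hS
  have hS0 := hS 0 0
  have hS1 := hS 0 1
  have hS2 := hS 1 0
  have hS3 := hS 1 1
  have hS4 := hS 1 (-1)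
  have e0 : 12 * d 0 = 0 := by linear_combination hS1 - hS0
  have e3 : d 3 = 0 := by
    have : 3 * d 3 = 0 := by linear_combination hS0 - hS2
    exact (mul_eq_zero.mp this).resolve_left h3
  by_cases h2 : (2 : k) = 0
  · have e1 : d 1 = 0 := by
      have : 3 * (3 * d 1) = 0 := by
        linear_combination hS0 - hS3 + e0 - 3 * e3 + 3 * d 2 * h2
      simpa [h3] using this
    have e2 : d 2 = 0 := by
      have : d 2 ^ 2 = 0 := by linear_combination hS0 - e0 * d 4 + 3 * d 1 * e3
      simpa using this
    by_cases d0 : d 0 = 0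
    · refine ⟨!![0, 1, 0; 1, 0, 0; 0, 0, 1], by simp [Matrix.det_fin_three],
        Or.inl ⟨![0, 1, 0, 0, d 4], by simp [Sinv], ?_⟩⟩
      intro x y z
      simp [act, hF, bq, d0, e1, e2, e3]
    · obtain ⟨r, hr⟩ := exists_root4 (d 0)
      obtain ⟨r', hr'⟩ := exists_root4 (d 4)
      have hr0 : r ≠ 0 := by
        rintro rfl
        apply d0
        rw [← hr]; simp
      refine ⟨!![0, 1, 0; r⁻¹, 0, -r' * r⁻¹; 0, 0, 1], by simp [Matrix.det_fin_three, hr0],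
        Or.inr (Or.inl ⟨?_, Or.inl (char2 h2)⟩)⟩
      intro x y z
      simp [act, hF, bq, e1, e2, e3, ← hr, ← hr']
      field_simp
      linear_combination (-2 * x ^ 3 * r' * z + 3 * x ^ 2 * r' ^ 2 * z ^ 2 - 2 * x * r' ^ 3 * z ^ 3
        + r' ^ 4 * z ^ 4) * h2
  · have h12 : (12 : k) ≠ 0 := by
      rw [show (12 : k) = 2 * 2 * 3 by norm_num]
      simp [h2, h3]
    have e0' : d 0 = 0 := by simpa [h12] using e0
    have e2 : d 2 = 0 := by
      have : 12 * d 2 = 0 := by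
        linear_combination hS3 - hS4 - 24 * e0' - 0 * e3
      simpa [h12] using this
    have e1 : d 1 = 0 := by
      have : 3 * (3 * d 1) = 0 := by
        linear_combination hS0 - hS3 + 12 * e0' - 3 * e3 + 6 * e2
      simpa [h3] using this
    refine ⟨!![0, 1, 0; 1, 0, 0; 0, 0, 1], by simp [Matrix.det_fin_three],
      Or.inl ⟨![0, 1, 0, 0, d 4], by simp [Sinv], ?_⟩⟩
    intro x y z
    simp [act, hF, bq, e0', e1, e2, e3]

lemma smooth13 [IsAlgClosed k] {p : ℕ} [CharP k p] (h3 : (3 : k) ≠ 0) (c : Fin 15 → k)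
    (hP : Pq (ev c)) (h0 : c 0 = 0) (h1 : c 1 = 0) (h2 : c 2 = 1) : Good p (ev c) := by
  have hi : Infinite k := IsAlgClosed.instInfinite
  have key : (![c 3 ^ 2, 2 * c 3 * c 4, c 4 ^ 2 + 2 * c 3 * c 5, 2 * c 4 * c 5, c 5 ^ 2]
      : Fin 5 → k) = ![0, 3 * c 6, 3 * c 7, 3 * c 8, 3 * c 9] := by
    apply bq_inj
    intro s t
    have := Pq_line hP s t
    rw [h0, h1, h2] at this
    simp [bq]
    linear_combination this
  have k0 := congrFun key 0
  have k1 := congrFun key 1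
  have k2 := congrFun key 2
  have k3 := congrFun key 3
  have k4 := congrFun key 4
  simp at k0 k1 k2 k3 k4
  rw [k0] at k1 k2
  have e6 : c 6 = 0 := by
    have : 3 * c 6 = 0 := by rw [← k1]; ring
    simpa [h3] using this
  obtain ⟨a, ha⟩ : ∃ a, c 4 = 3 * a := ⟨c 4 / 3, by field_simp⟩
  obtain ⟨b, hb⟩ : ∃ b, c 5 = 3 * b := ⟨c 5 / 3, by field_simp⟩
  rw [ha] at k2 k3
  rw [hb] at k3 k4
  have e7 : c 7 = 3 * a ^ 2 := mul_left_cancel₀ h3 (by linear_combination -k2)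
  have e8 : c 8 = 6 * a * b := mul_left_cancel₀ h3 (by linear_combination -k3)
  have e9 : c 9 = 3 * b ^ 2 := mul_left_cancel₀ h3 (by linear_combination -k4)
  apply good_act !![1, -a, -b; 0, 1, 0; 0, 0, 1] (by simp [Matrix.det_fin_three])
  apply finish13 h3 _ ![c 10, c 11 - a ^ 3, c 12 - 3 * a ^ 2 * b,
    c 13 - 3 * a * b ^ 2, c 14 - b ^ 3] _ (Pq_act _ hP)
  intro x y z
  simp [act, ev, bq, h0, h1, h2, k0, e6, e7, e8, e9, ha, hb]
  ring

def TF (A : Matrix (Fin 3) (Fin 3) k) (x y z : k) : k :=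
  x ^ 3 * (A 0 0 * x + A 0 1 * y + A 0 2 * z) + y ^ 3 * (A 1 0 * x + A 1 1 * y + A 1 2 * z)
    + z ^ 3 * (A 2 0 * x + A 2 1 * y + A 2 2 * z)

def Bf (A : Matrix (Fin 3) (Fin 3) k) (u v : Fin 3 → k) : k :=
  u 0 ^ 3 * (A 0 0 * v 0 + A 0 1 * v 1 + A 0 2 * v 2)
    + u 1 ^ 3 * (A 1 0 * v 0 + A 1 1 * v 1 + A 1 2 * v 2)
    + u 2 ^ 3 * (A 2 0 * v 0 + A 2 1 * v 1 + A 2 2 * v 2)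

lemma act_TF (h3 : (3 : k) = 0) (M A : Matrix (Fin 3) (Fin 3) k) :
    act M (TF A) = TF (Matrix.of fun i j => Bf A (fun a => M a i) (fun a => M a j)) := by
  have cube : ∀ a b c : k, (a + b + c) ^ 3 = a ^ 3 + b ^ 3 + c ^ 3 := by
    intro a b c
    linear_combination (a ^ 2 * b + a ^ 2 * c + a * b ^ 2 + 2 * a * b * c + a * c ^ 2 + b ^ 2 * c
      + b * c ^ 2) * h3
  funext x y z
  simp only [act, TF, cube, Bf, Matrix.of_apply]
  ring

/-- move: columns `u, v, w` of the coordinate change. -/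
lemma mv (h3 : (3 : k) = 0) {p : ℕ} {A : Matrix (Fin 3) (Fin 3) k} (u v w : Fin 3 → k)
    (hdet : u 0 * (v 1 * w 2 - v 2 * w 1) - v 0 * (u 1 * w 2 - u 2 * w 1)
      + w 0 * (u 1 * v 2 - u 2 * v 1) ≠ 0)
    (h : Good p (TF !![Bf A u u, Bf A u v, Bf A u w; Bf A v u, Bf A v v, Bf A v w;
      Bf A w u, Bf A w v, Bf A w w])) : Good p (TF A) := by
  have hM : (!![u 0, v 0, w 0; u 1, v 1, w 1; u 2, v 2, w 2]).det ≠ 0 := by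
    rw [Matrix.det_fin_three]
    intro hc
    apply hdet
    rw [← hc]
    simp
    ring
  apply good_act _ hM
  rw [act_TF h3]
  convert h using 2
  have e1 : (fun a => !![u 0, v 0, w 0; u 1, v 1, w 1; u 2, v 2, w 2] a 0) = u := by
    funext a; fin_cases a <;> rfl
  have e2 : (fun a => !![u 0, v 0, w 0; u 1, v 1, w 1; u 2, v 2, w 2] a 1) = v := by
    funext a; fin_cases a <;> rfl
  have e3 : (fun a => !![u 0, v 0, w 0; u 1, v 1, w 1; u 2, v 2, w 2] a 2) = w := by
    funext a; fin_cases a <;> rfl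
  ext i j
  fin_cases i <;> fin_cases j <;> simp [Bf]

lemma good_bin (h3 : (3 : k) = 0) {p : ℕ} (a b c d : k) :
    Good p (TF !![0, 0, 0; 0, a, b; 0, c, d]) := by
  refine ⟨1, by simp, Or.inl ⟨![a, b, 0, c, d], ?_, ?_⟩⟩
  · simp [Sinv]
    linear_combination (4 * a * d - b * c) * h3
  · intro x y z
    simp [act_one, TF, bq]
    ring

lemma good_ii (h3 : (3 : k) = 0) {p : ℕ} [CharP k p] :
    Good p (TF (!![1, 0, 0; 0, 0, 1; 0, 0, 0] : Matrix (Fin 3) (Fin 3) k)) := by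
  refine ⟨1, by simp, Or.inr (Or.inl ⟨?_, Or.inr (char3 h3)⟩)⟩
  intro x y z
  simp [act_one, TF]
  ring

lemma good_iii (h3 : (3 : k) = 0) {p : ℕ} [CharP k p] :
    Good p (TF (!![0, 1, 0; 0, 0, 0; 1, 0, 0] : Matrix (Fin 3) (Fin 3) k)) := by
  refine ⟨1, by simp, Or.inr (Or.inr (Or.inl ⟨?_, char3 h3⟩))⟩
  intro x y z
  simp [act_one, TF]
  ring

lemma good_iv (h3 : (3 : k) = 0) {p : ℕ} [CharP k p] :
    Good p (TF (!![1, 0, 0; 0, 1, 0; 0, 0, 1] : Matrix (Fin 3) (Fin 3) k)) := by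
  refine ⟨1, by simp, Or.inr (Or.inr (Or.inr ⟨?_, char3 h3⟩))⟩
  intro x y z
  simp [act_one, TF]
  ring

variable [IsAlgClosed k]

lemma exists_root_n (d : k) (n : ℕ) (hn : 0 < n) : ∃ r, r ^ n = d :=
  IsAlgClosed.exists_pow_nat_eq d hn

lemma root_poly (P : Polynomial k) (n : ℕ) (hn : 0 < n) (h : P.coeff n ≠ 0) :
    ∃ x, P.eval x = 0 := by
  apply IsAlgClosed.exists_root
  intro hd
  have := Polynomial.eq_C_of_degree_eq_zero hd
  rw [this, Polynomial.coeff_C, if_neg (by omega)] at h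
  exact h rfl

lemma alpha0_c (h3 : (3 : k) = 0) {p : ℕ} [CharP k p] (β : k) :
    Good p (TF !![0, 0, 1; 0, 1, 0; β, 0, 0]) := by
  by_cases hβ : β = 0
  · subst hβ
    apply mv h3 ![0, 1, 0] ![1, 0, 0] ![0, 0, 1] (by simp)
    convert good_ii (k := k) h3 using 2
    simp [Bf]
  · obtain ⟨κ, hκ⟩ := exists_root_n β 8 (by norm_num)
    obtain ⟨a, ha⟩ := exists_root4 (-1 : k)
    have hκ0 : κ ≠ 0 := by
      rintro rfl
      apply hβ; rw [← hκ]; simp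
    have ha0 : a ≠ 0 := by
      rintro rfl
      simp at ha
    have h2 : (2 : k) ≠ 0 := by
      intro h2
      exact one_ne_zero (α := k) (by linear_combination h3 - h2)
    apply mv h3 ![0, 1, 0] ![κ * a, 0, κ⁻¹ ^ 3 * a] ![κ * a ^ 2, 0, -κ⁻¹ ^ 3 * a ^ 2] (by
      simp
      field_simp
      intro hc
      apply h2
      apply mul_left_cancel₀ (pow_ne_zero 3 ha0)
      linear_combination hc)
    convert good_iv (k := k) h3 using 2
    ext i j
    fin_cases i <;> fin_cases j <;> simp [Bf] <;> rw [← hκ] <;> field_simp <;> try ring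
    · linear_combination 2 * ha - h3
    · linear_combination (-2 * (a ^ 4 - 1)) * ha - h3

lemma alpha0_b (h3 : (3 : k) = 0) {p : ℕ} [CharP k p] (β d3 d4 : k) :
    Good p (TF !![0, 0, 1; 0, 1, 0; β, d3, d4]) := by
  obtain ⟨μ, hμ⟩ : ∃ μ : k, μ ^ 9 - β * μ + d3 = 0 := by
    obtain ⟨x, hx⟩ := root_poly (Polynomial.X ^ 9 - Polynomial.C β * Polynomial.X
      + Polynomial.C d3) 9 (by norm_num) (by simp [Polynomial.coeff_X, Polynomial.coeff_C])
    exact ⟨x, by simpa using hx⟩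
  obtain ⟨ν, hν⟩ : ∃ ν : k, ν ^ 3 + β * ν + (μ ^ 12 + d3 * μ ^ 3 + d4) = 0 := by
    generalize μ ^ 12 + d3 * μ ^ 3 + d4 = e
    obtain ⟨x, hx⟩ := root_poly (Polynomial.X ^ 3 + Polynomial.C β * Polynomial.X
      + Polynomial.C e) 3 (by norm_num)
      (by simp [Polynomial.coeff_X, Polynomial.coeff_C])
    exact ⟨x, by simpa using hx⟩
  apply mv h3 ![1, 0, 0] ![-μ, 1, 0] ![ν, μ ^ 3, 1] (by simp)
  convert alpha0_c (k := k) h3 β using 2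
  ext i j
  fin_cases i <;> fin_cases j <;> simp [Bf] <;> try ring
  · linear_combination hμ
  · linear_combination hν

lemma alpha0 (h3 : (3 : k) = 0) {p : ℕ} [CharP k p] (d0 d1 β d3 d4 : k) :
    Good p (TF !![0, 0, 1; 0, d0, d1; β, d3, d4]) := by
  obtain ⟨δ, hδ⟩ := exists_root_n d1 3 (by norm_num)
  apply mv h3 ![1, 0, 0] ![-δ, 1, 0] ![0, 0, 1] (by simp)
  suffices h : ∀ d3, Good p (TF !![0, 0, 1; 0, d0, 0; β, d3, d4]) by
    convert h (d3 - β * δ) using 2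
    ext i j
    fin_cases i <;> fin_cases j <;> simp [Bf] <;> try ring
    linear_combination -hδ
  clear hδ d3
  intro d3
  by_cases h0 : d0 = 0
  · subst h0
    by_cases hd : d3 = 0
    · subst hd
      apply mv h3 ![0, 1, 0] ![1, 0, 0] ![0, 0, 1] (by simp)
      convert good_bin (k := k) h3 0 1 β d4 using 2
      ext i j
      fin_cases i <;> fin_cases j <;> simp [Bf]
    · apply mv h3 ![0, -d4 * d3⁻¹, 1] ![0, d3⁻¹, 0] ![1, -β * d3⁻¹, 0] (by simp [hd])
      convert good_iii (k := k) h3 using 2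
      ext i j
      fin_cases i <;> fin_cases j <;> simp [Bf, hd] <;> field_simp <;> try ring
  · obtain ⟨r, hr⟩ := exists_root4 d0
    have hr0 : r ≠ 0 := by
      rintro rfl
      apply h0; rw [← hr]; simp
    apply mv h3 ![1, 0, 0] ![0, r⁻¹, 0] ![0, 0, 1] (by simp [hr0])
    convert alpha0_b (k := k) h3 β (d3 * r⁻¹) d4 using 2
    ext i j
    fin_cases i <;> fin_cases j <;> simp [Bf]
    rw [← hr]
    field_simp

lemma split_a (h3 : (3 : k) = 0) {p : ℕ} [CharP k p] (f g h : k) :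
    Good p (TF !![1, 0, 0; 0, 0, f; 0, g, h]) := by
  by_cases hf : f = 0
  · subst hf
    by_cases hg : g = 0
    · subst hg
      apply mv h3 ![0, 1, 0] ![1, 0, 0] ![0, 0, 1] (by simp)
      convert good_bin (k := k) h3 1 0 0 h using 2
      ext i j
      fin_cases i <;> fin_cases j <;> simp [Bf]
    · apply mv h3 ![1, 0, 0] ![0, -h * g⁻¹, 1] ![0, g⁻¹, 0] (by simp [hg])
      convert good_ii (k := k) h3 using 2
      ext i j
      fin_cases i <;> fin_cases j <;> simp [Bf, hg] <;> field_simp <;> try ring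
  · apply mv h3 ![0, 1, 0] ![1, 0, 0] ![0, 0, f⁻¹] (by simp [hf])
    convert alpha0 (k := k) h3 1 0 (f⁻¹ ^ 3 * g) 0 (f⁻¹ ^ 3 * (h * f⁻¹)) using 2
    ext i j
    fin_cases i <;> fin_cases j <;> simp [Bf, hf]

lemma split_b (h3 : (3 : k) = 0) {p : ℕ} [CharP k p] (N e f g h : k) (hN : N ≠ 0) :
    Good p (TF !![N, 0, 0; 0, e, f; 0, g, h]) := by
  obtain ⟨r, hr⟩ := exists_root4 N
  have hr0 : r ≠ 0 := by
    rintro rfl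
    apply hN; rw [← hr]; simp
  by_cases he : e = 0
  · subst he
    apply mv h3 ![r⁻¹, 0, 0] ![0, 1, 0] ![0, 0, 1] (by simp [hr0])
    convert split_a (k := k) h3 f g h using 2
    ext i j
    fin_cases i <;> fin_cases j <;> simp [Bf]
    rw [← hr]
    field_simp
  · obtain ⟨y, hy⟩ : ∃ y : k, e * y ^ 4 + f * y ^ 3 + g * y + h = 0 := by
      obtain ⟨x, hx⟩ := root_poly (Polynomial.C e * Polynomial.X ^ 4
        + Polynomial.C f * Polynomial.X ^ 3 + Polynomial.C g * Polynomial.X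
        + Polynomial.C h) 4 (by norm_num)
        (by simp [Polynomial.coeff_X, Polynomial.coeff_C, he])
      exact ⟨x, by simpa using hx⟩
    apply mv h3 ![r⁻¹, 0, 0] ![0, y, 1] ![0, 1, 0] (by simp [hr0])
    convert split_a (k := k) h3 (y ^ 3 * e + g) (e * y + f) e using 2
    ext i j
    fin_cases i <;> fin_cases j <;> simp [Bf]
    · rw [← hr]
      field_simp
    · linear_combination hy

lemma klein (h3 : (3 : k) = 0) {p : ℕ} [CharP k p] (d : k) :
    Good p (TF !![0, 0, 1; 1, 0, 0; 0, 1, d]) := by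
  obtain ⟨t, ht⟩ : ∃ t : k, t ^ 728 + d ^ 3 * t ^ 80 - d * t ^ 8 - 1 = 0 := by
    obtain ⟨x, hx⟩ := root_poly (Polynomial.X ^ 728 + Polynomial.C (d ^ 3) * Polynomial.X ^ 80
        - Polynomial.C d * Polynomial.X ^ 8 - Polynomial.C 1) 728 (by norm_num)
        (by simp [Polynomial.coeff_one, Polynomial.coeff_X_pow, - map_pow])
    exact ⟨x, by simpa using hx⟩
  have ht0 : t ≠ 0 := by
    rintro rfl
    simp at ht
  have hsp : ∀ v : Fin 3 → k, Bf !![0, 0, 1; 1, 0, 0; 0, 1, d] v ![t ^ 81, t, t ^ 9]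
      = (Bf !![0, 0, 1; 1, 0, 0; 0, 1, d] ![t ^ 81, t, t ^ 9] v) ^ 3 := by
    intro v
    have cube : ∀ a b c : k, (a + b + c) ^ 3 = a ^ 3 + b ^ 3 + c ^ 3 := by
      intro a b c
      linear_combination (a ^ 2 * b + a ^ 2 * c + a * b ^ 2 + 2 * a * b * c + a * c ^ 2 + b ^ 2 * c
        + b * c ^ 2) * h3
    have cube2 : ∀ a b : k, (a + b) ^ 3 = a ^ 3 + b ^ 3 := by
      intro a b
      linear_combination (a ^ 2 * b + a * b ^ 2) * h3
    simp only [Bf]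
    simp
    rw [cube, mul_pow _ (v 1 + d * v 2), cube2]
    linear_combination (-t * v 2 ^ 3) * ht
  by_cases hN : Bf !![0, 0, 1; 1, 0, 0; 0, 1, d] ![t ^ 81, t, t ^ 9] ![t ^ 81, t, t ^ 9] = 0
  · apply mv h3 ![t ^ 81, t, t ^ 9] ![-t ^ 24, 1, 0] ![t⁻¹ ^ 3, 0, 0] (by simp [ht0])
    have e1 : Bf !![0, 0, 1; 1, 0, 0; 0, 1, d] ![t ^ 81, t, t ^ 9] ![-t ^ 24, 1, 0] = 0 := by
      simp [Bf]; ring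
    have e2 : Bf !![0, 0, 1; 1, 0, 0; 0, 1, d] ![t ^ 81, t, t ^ 9] ![t⁻¹ ^ 3, 0, 0] = 1 := by
      simp [Bf]; field_simp
    rw [hsp ![-t ^ 24, 1, 0], hN, e1, e2, zero_pow (by norm_num)]
    apply alpha0 h3
  · apply mv h3 ![t ^ 81, t, t ^ 9] ![-t ^ 24, 1, 0] ![t ^ 243 + d * t ^ 27, 0, -t ^ 3] (by
      intro hc
      apply hN
      simp at hc
      simp [Bf]
      linear_combination -hc)
    have e1 : Bf !![0, 0, 1; 1, 0, 0; 0, 1, d] ![t ^ 81, t, t ^ 9] ![-t ^ 24, 1, 0] = 0 := by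
      simp [Bf]; ring
    have e2 : Bf !![0, 0, 1; 1, 0, 0; 0, 1, d] ![t ^ 81, t, t ^ 9]
        ![t ^ 243 + d * t ^ 27, 0, -t ^ 3] = 0 := by
      simp [Bf]; ring
    rw [hsp ![-t ^ 24, 1, 0], hsp ![t ^ 243 + d * t ^ 27, 0, -t ^ 3], e1, e2,
      zero_pow (by norm_num)]
    apply split_b h3 _ _ _ _ _ hN

lemma alpha1_c (h3 : (3 : k) = 0) {p : ℕ} [CharP k p] (d3 d4 : k) :
    Good p (TF !![0, 0, 1; 1, 0, 0; 0, d3, d4]) := by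
  by_cases hd : d3 = 0
  · subst hd
    obtain ⟨δ, rfl⟩ := exists_root_n d4 3 (by norm_num)
    by_cases hδ : δ = 0
    · subst hδ
      apply mv h3 ![1, 0, 0] ![0, 0, 1] ![0, 1, 0] (by simp)
      convert good_iii (k := k) h3 using 2
      ext i j
      fin_cases i <;> fin_cases j <;> simp [Bf]
    · obtain ⟨ε, hε⟩ := exists_root_n δ⁻¹ 3 (by norm_num)
      obtain ⟨ρ, hρ⟩ := exists_root4 δ
      have hρ0 : ρ ≠ 0 := by
        rintro rfl
        apply hδ; rw [← hρ]; simp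
      apply mv h3 ![0, ε * ρ, ρ * δ⁻¹] ![0, 1, 0] ![1, 0, -δ⁻¹] (by simp [hρ0, hδ])
      convert good_ii (k := k) h3 using 2
      ext i j
      fin_cases i <;> fin_cases j <;> simp [Bf, hδ, mul_pow, hε] <;> field_simp <;> try ring
      rw [← hρ]
  · obtain ⟨b, hb⟩ := exists_root_n d3⁻¹ 28 (by norm_num)
    have hb0 : b ≠ 0 := by
      rintro rfl
      simp at hb
      exact hd hb.symm
    have hb' : b ^ 28 * d3 = 1 := by rw [hb]; field_simp
    apply mv h3 ![b⁻¹ ^ 3, 0, 0] ![0, b, 0] ![0, 0, b ^ 9] (by simp [hb0])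
    convert klein (k := k) h3 (b ^ 36 * d4) using 2
    ext i j
    fin_cases i <;> fin_cases j <;> simp [Bf, hd] <;> try field_simp
    linear_combination hb'

lemma alpha1_b (h3 : (3 : k) = 0) {p : ℕ} [CharP k p] (α β d3 d4 : k) (hα : α ≠ 0) :
    Good p (TF !![0, 0, 1; α, 0, 0; β, d3, d4]) := by
  obtain ⟨r, rfl⟩ := exists_root_n α 3 (by norm_num)
  have hr : r ≠ 0 := by
    rintro rfl
    simp at hα
  obtain ⟨τ, rfl⟩ := exists_root_n β 3 (by norm_num)
  apply mv h3 ![1, 0, 0] ![0, r⁻¹, 0] ![0, -τ * r⁻¹, 1] (by simp [hr])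
  convert alpha1_c (k := k) h3 (d3 * r⁻¹) (d4 - d3 * τ * r⁻¹) using 2
  ext i j
  fin_cases i <;> fin_cases j <;> simp [Bf] <;> field_simp <;> ring

lemma alpha1 (h3 : (3 : k) = 0) {p : ℕ} [CharP k p] (α d0 d1 β d3 d4 : k) :
    Good p (TF !![0, 0, 1; α, d0, d1; β, d3, d4]) := by
  by_cases hα : α = 0
  · subst hα
    exact alpha0 h3 _ _ _ _ _
  obtain ⟨m, rfl⟩ : ∃ m, d0 = α * m := ⟨d0 / α, by field_simp⟩
  apply mv h3 ![1, 0, 0] ![-m, 1, 0] ![0, 0, 1] (by simp)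
  obtain ⟨n, hn⟩ : ∃ n, d1 - m ^ 3 = α * n := ⟨(d1 - m ^ 3) / α, by field_simp⟩
  apply mv h3 ![1, 0, 0] ![0, 1, 0] ![-n, 0, 1] (by simp)
  convert alpha1_b (k := k) h3 α β (d3 - β * m) (d4 - β * n - n ^ 3) hα using 2
  ext i j
  fin_cases i <;> fin_cases j <;> simp [Bf] <;> try ring
  linear_combination hn

lemma sq3 (h3 : (3 : k) = 0) {f : Fin 5 → k} (h : Sinv f = 0) : f 2 = 0 := by
  have : f 2 ^ 2 = 0 := by
    rw [Sinv] at h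
    linear_combination h - (4 * f 0 * f 4 - f 1 * f 3) * h3
  simpa using this


lemma sq3' (h3 : (3 : k) = 0) {f : Fin 5 → k} (h : f 2 = 0) : Sinv f = 0 := by
  rw [Sinv, h]
  linear_combination (4 * f 0 * f 4 - f 1 * f 3) * h3

lemma smooth3 {p : ℕ} [CharP k p] (h3 : (3 : k) = 0) (c : Fin 15 → k)
    (hP : Pq (ev c)) (h0 : c 0 = 0) (h1 : c 1 = 0) (h2 : c 2 = 1) : Good p (ev c) := by
  have e3 : c 3 = 0 := by
    refine sq3 h3 (hP ![1, 0, 0] ![0, 1, 0] ![c 0, c 1, c 3, c 6, c 10] ?_)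
    intro s t
    simp [ev, bq]; ring
  have e5 : c 5 = 0 := by
    refine sq3 h3 (hP ![1, 0, 0] ![0, 0, 1] ![c 0, c 2, c 5, c 9, c 14] ?_)
    intro s t
    simp [ev, bq]; ring
  have e12 : c 12 = 0 := by
    refine sq3 h3 (hP ![0, 1, 0] ![0, 0, 1] ![c 10, c 11, c 12, c 13, c 14] ?_)
    intro s t
    simp [ev, bq]
  have e4 : c 4 = 0 := by
    have : c 3 + c 4 + c 5 = 0 := by
      refine sq3 h3 (hP ![1, 0, 0] ![0, 1, 1] ![c 0, c 1 + c 2, c 3 + c 4 + c 5,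
        c 6 + c 7 + c 8 + c 9, c 10 + c 11 + c 12 + c 13 + c 14] ?_)
      intro s t
      simp [ev, bq]; ring
    simpa [e3, e5] using this
  have e7 : c 7 = 0 := by
    have : c 3 + c 7 + c 12 = 0 := by
      refine sq3 h3 (hP ![0, 1, 0] ![1, 0, 1] ![c 10, c 6 + c 11, c 3 + c 7 + c 12,
        c 1 + c 4 + c 8 + c 13, c 0 + c 2 + c 5 + c 9 + c 14] ?_)
      intro s t
      simp [ev, bq]; ring
    simpa [e3, e12] using this
  have e8 : c 8 = 0 := by
    have : c 5 + c 8 + c 12 = 0 := by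
      refine sq3 h3 (hP ![0, 0, 1] ![1, 1, 0] ![c 14, c 9 + c 13, c 5 + c 8 + c 12,
        c 2 + c 4 + c 7 + c 11, c 0 + c 1 + c 3 + c 6 + c 10] ?_)
      intro s t
      simp [ev, bq]; ring
    simpa [e5, e12] using this
  convert alpha1 (p := p) h3 (c 6) (c 10) (c 11) (c 9) (c 13) (c 14) using 1
  funext x y z
  simp [ev, TF, h0, h1, h2, e3, e4, e5, e7, e8, e12]
  ring

lemma smooth {p : ℕ} [CharP k p] (c : Fin 15 → k) (hQ : IsQ (ev c)) (hP : Pq (ev c))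
    (h0 : c 0 = 0) (h12 : c 1 ≠ 0 ∨ c 2 ≠ 0) : Good p (ev c) := by
  have hi : Infinite k := IsAlgClosed.instInfinite
  refine normL (fun c _ hP h0 h1 h2 => ?_) c hQ hP h0 h12
  by_cases h3 : (3 : k) = 0
  · exact smooth3 h3 c hP h0 h1 h2
  · exact smooth13 h3 c hP h0 h1 h2

lemma classify0 {p : ℕ} [CharP k p] (c : Fin 15 → k) (hQ : IsQ (ev c)) (hP : Pq (ev c))
    (h0 : c 0 = 0) : Good p (ev c) := by
  have hi : Infinite k := IsAlgClosed.instInfinite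
  by_cases h12 : c 1 ≠ 0 ∨ c 2 ≠ 0
  · exact smooth c hQ hP h0 h12
  push Not at h12
  obtain ⟨h1, h2⟩ := h12
  have hl : ∀ y z, c 3 * y ^ 2 + c 4 * y * z + c 5 * z ^ 2 = 0 := by
    intro y z
    have := Pq_line hP y z
    rw [h0, h1, h2] at this
    have h : (c 3 * y ^ 2 + c 4 * y * z + c 5 * z ^ 2) ^ 2 = 0 := by linear_combination this
    simpa using h
  have e3 : c 3 = 0 := by simpa using hl 1 0
  have e5 : c 5 = 0 := by simpa using hl 0 1
  have e4 : c 4 = 0 := by simpa [e3, e5] using hl 1 1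
  by_cases hC : ∀ y z, c 6 * y ^ 3 + c 7 * y ^ 2 * z + c 8 * y * z ^ 2 + c 9 * z ^ 3 = 0
  · refine ⟨1, by simp, Or.inl ⟨![c 10, c 11, c 12, c 13, c 14], ?_, ?_⟩⟩
    · apply hP ![0, 1, 0] ![0, 0, 1]
      intro s t
      simp [ev, bq]
    · intro x y z
      simp [act_one, ev, bq, h0, h1, h2, e3, e4, e5, hC]
  · push Not at hC
    obtain ⟨y, z, hC⟩ := hC
    obtain ⟨x, hx⟩ : ∃ x, x * (c 6 * y ^ 3 + c 7 * y ^ 2 * z + c 8 * y * z ^ 2 + c 9 * z ^ 3)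
        + (c 10 * y ^ 4 + c 11 * y ^ 3 * z + c 12 * y ^ 2 * z ^ 2 + c 13 * y * z ^ 3
          + c 14 * z ^ 4) = 0 :=
      ⟨-(c 10 * y ^ 4 + c 11 * y ^ 3 * z + c 12 * y ^ 2 * z ^ 2 + c 13 * y * z ^ 3
          + c 14 * z ^ 4) / (c 6 * y ^ 3 + c 7 * y ^ 2 * z + c 8 * y * z ^ 2 + c 9 * z ^ 3), by
        rw [div_mul_cancel₀ _ hC]; ring⟩
    have key : ∀ m n : k, y * n - z * m ≠ 0 → Good p (ev c) := by
      intro m n hmn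
      have hM : (!![x, 1, 0; y, 0, m; z, 0, n]).det ≠ 0 := by
        rw [Matrix.det_fin_three]
        intro hc
        apply hmn
        simp at hc
        linear_combination -hc
      apply good_act _ hM
      obtain ⟨c', hc'⟩ := IsQ_ev (IsQ_act !![x, 1, 0; y, 0, m; z, 0, n] hQ)
      have fo := first_order hc' (y := 1) (z := 0)
        (f := ![0, c 6 * y ^ 3 + c 7 * y ^ 2 * z + c 8 * y * z ^ 2 + c 9 * z ^ 3, 0, 0, 0]) (by
        intro s t
        simp [act, ev, bq, h0, h1, h2, e3, e4, e5]
        linear_combination s ^ 4 * hx)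
      simp at fo
      rw [hc']
      refine smooth c' ?_ ?_ fo.1 (Or.inl ?_)
      · rw [← hc']; exact IsQ_act _ hQ
      · rw [← hc']; exact Pq_act _ hP
      · rw [fo.2]; exact hC
    by_cases hy : y = 0
    · have hz : z ≠ 0 := by
        rintro rfl
        apply hC; rw [hy]; ring
      exact key 1 0 (by simpa using hz)
    · exact key 0 1 (by simpa using hy)

lemma classify {p : ℕ} [CharP k p] (F : k → k → k → k) (hQ : IsQ F) (hP : Pq F) :
    Good p F := by
  have hi : Infinite k := IsAlgClosed.instInfinite
  obtain ⟨c, rfl⟩ := IsQ_ev hQ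
  by_cases h0 : c 0 = 0
  · exact classify0 c hQ hP h0
  obtain ⟨x, hx⟩ : ∃ x : k, c 0 * x ^ 4 + c 1 * x ^ 3 + c 3 * x ^ 2 + c 6 * x + c 10 = 0 := by
    obtain ⟨x, hx⟩ := root_poly (Polynomial.C (c 0) * Polynomial.X ^ 4
      + Polynomial.C (c 1) * Polynomial.X ^ 3 + Polynomial.C (c 3) * Polynomial.X ^ 2
      + Polynomial.C (c 6) * Polynomial.X
      + Polynomial.C (c 10)) 4 (by norm_num)
      (by simp [Polynomial.coeff_X, Polynomial.coeff_C, h0])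
    exact ⟨x, by simpa using hx⟩
  have hM : (!![x, 1, 0; 1, 0, 0; 0, 0, 1]).det ≠ 0 := by
    simp [Matrix.det_fin_three]
  apply good_act _ hM
  obtain ⟨c', hc'⟩ := IsQ_ev (IsQ_act !![x, 1, 0; 1, 0, 0; 0, 0, 1] hQ)
  have fo := first_order hc' (y := 0) (z := 0) (f := ![0, 0, 0, 0, 0]) (by
    intro s t
    simp [act, ev, bq]
    linear_combination s ^ 4 * hx)
  rw [hc']
  refine classify0 c' ?_ ?_ fo.1
  · rw [← hc']; exact IsQ_act _ hQ
  · rw [← hc']; exact Pq_act _ hP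

lemma Pq_intro {F : k → k → k → k} (g : (Fin 3 → k) → (Fin 3 → k) → Fin 5 → k)
    (hg : ∀ a b s t, F (s * a 0 + t * b 0) (s * a 1 + t * b 1) (s * a 2 + t * b 2)
      = bq (g a b) s t)
    (hS : ∀ a b, Sinv (g a b) = 0) : Pq F := by
  have hi : Infinite k := IsAlgClosed.instInfinite
  intro a b f hf
  rw [bq_inj (fun s t => (hf s t).symm.trans (hg a b s t))]
  exact hS a b

lemma Pq_i (f : Fin 5 → k) (hf : Sinv f = 0) : Pq (fun _ y z => bq f y z) := by
  apply Pq_intro (fun a b => bqsub f (a 1) (b 1) (a 2) (b 2))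
  · intro a b s t
    rw [← bq_bqsub]
    congr 1 <;> ring
  · intro a b
    rw [Sinv_bqsub, hf, mul_zero]

lemma Pq_ii (h : (2 : k) = 0 ∨ (3 : k) = 0) : Pq (fun x y z : k => x ^ 4 + y ^ 3 * z) := by
  apply Pq_intro (fun a b => ![a 0 ^ 4 + a 1 ^ 3 * a 2,
    4 * a 0 ^ 3 * b 0 + a 1 ^ 3 * b 2 + 3 * a 1 ^ 2 * b 1 * a 2,
    6 * a 0 ^ 2 * b 0 ^ 2 + 3 * a 1 ^ 2 * b 1 * b 2 + 3 * a 1 * b 1 ^ 2 * a 2,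
    4 * a 0 * b 0 ^ 3 + b 1 ^ 3 * a 2 + 3 * a 1 * b 1 ^ 2 * b 2,
    b 0 ^ 4 + b 1 ^ 3 * b 2])
  · intro a b s t
    simp [bq]; ring
  · intro a b
    rcases h with h2 | h3
    · have e1 : 4 * a 0 ^ 3 * b 0 + a 1 ^ 3 * b 2 + 3 * a 1 ^ 2 * b 1 * a 2
          = a 1 ^ 2 * (a 1 * b 2 + b 1 * a 2) := by
        linear_combination (2 * a 0 ^ 3 * b 0 + a 1 ^ 2 * b 1 * a 2) * h2
      have e2 : 6 * a 0 ^ 2 * b 0 ^ 2 + 3 * a 1 ^ 2 * b 1 * b 2 + 3 * a 1 * b 1 ^ 2 * a 2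
          = a 1 * b 1 * (a 1 * b 2 + b 1 * a 2) := by
        linear_combination (3 * a 0 ^ 2 * b 0 ^ 2 + a 1 * b 1 * (a 1 * b 2 + b 1 * a 2)) * h2
      have e3 : 4 * a 0 * b 0 ^ 3 + b 1 ^ 3 * a 2 + 3 * a 1 * b 1 ^ 2 * b 2
          = b 1 ^ 2 * (a 1 * b 2 + b 1 * a 2) := by
        linear_combination (2 * a 0 * b 0 ^ 3 + a 1 * b 1 ^ 2 * b 2) * h2
      rw [e1, e2, e3]
      simp [Sinv]
      linear_combination (6 * (a 0 ^ 4 + a 1 ^ 3 * a 2) * (b 0 ^ 4 + b 1 ^ 3 * b 2)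
        - (a 1 * b 1 * (a 1 * b 2 + b 1 * a 2)) ^ 2) * h2
    · apply sq3' h3
      simp
      linear_combination (2 * a 0 ^ 2 * b 0 ^ 2 + a 1 ^ 2 * b 1 * b 2 + a 1 * b 1 ^ 2 * a 2) * h3

lemma Pq_iii (h3 : (3 : k) = 0) : Pq (fun x y z : k => x * (x ^ 2 * y + z ^ 3)) := by
  apply Pq_intro (fun a b => ![a 0 ^ 3 * a 1 + a 2 ^ 3 * a 0,
    a 0 ^ 3 * b 1 + 3 * a 0 ^ 2 * b 0 * a 1 + a 2 ^ 3 * b 0 + 3 * a 2 ^ 2 * b 2 * a 0,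
    3 * (a 0 ^ 2 * b 0 * b 1 + a 0 * b 0 ^ 2 * a 1 + a 2 ^ 2 * b 2 * b 0 + a 2 * b 2 ^ 2 * a 0),
    b 0 ^ 3 * a 1 + 3 * a 0 * b 0 ^ 2 * b 1 + b 2 ^ 3 * a 0 + 3 * a 2 * b 2 ^ 2 * b 0,
    b 0 ^ 3 * b 1 + b 2 ^ 3 * b 0])
  · intro a b s t
    simp [bq]; ring
  · intro a b
    apply sq3' h3
    simp [h3]

lemma Pq_iv (h3 : (3 : k) = 0) : Pq (fun x y z : k => x ^ 4 + y ^ 4 + z ^ 4) := by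
  apply Pq_intro (fun a b => ![a 0 ^ 4 + a 1 ^ 4 + a 2 ^ 4,
    4 * (a 0 ^ 3 * b 0 + a 1 ^ 3 * b 1 + a 2 ^ 3 * b 2),
    3 * (2 * (a 0 ^ 2 * b 0 ^ 2 + a 1 ^ 2 * b 1 ^ 2 + a 2 ^ 2 * b 2 ^ 2)),
    4 * (a 0 * b 0 ^ 3 + a 1 * b 1 ^ 3 + a 2 * b 2 ^ 3),
    b 0 ^ 4 + b 1 ^ 4 + b 2 ^ 4])
  · intro a b s t
    simp [bq]; ring
  · intro a b
    apply sq3' h3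
    simp [h3]

lemma Pq_of_Good {p : ℕ} [CharP k p] {F : k → k → k → k} (h : Good p F) : Pq F := by
  obtain ⟨M, hM, h⟩ := h
  have t3 : p = 3 → (3 : k) = 0 := by
    rintro rfl
    exact_mod_cast CharP.cast_eq_zero k 3
  have t2 : p = 2 → (2 : k) = 0 := by
    rintro rfl
    exact_mod_cast CharP.cast_eq_zero k 2
  apply Pq_of_act M hM
  rcases h with ⟨f, hf, h⟩ | ⟨h, hp⟩ | ⟨h, hp⟩ | ⟨h, hp⟩
  · rw [show act M F = fun _ y z => bq f y z by funext x y z; exact h x y z]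
    exact Pq_i f hf
  · rw [show act M F = fun x y z => x ^ 4 + y ^ 3 * z by funext x y z; exact h x y z]
    exact Pq_ii (hp.imp t2 t3)
  · rw [show act M F = fun x y z => x * (x ^ 2 * y + z ^ 3) by funext x y z; exact h x y z]
    exact Pq_iii (t3 hp)
  · rw [show act M F = fun x y z => x ^ 4 + y ^ 4 + z ^ 4 by funext x y z; exact h x y z]
    exact Pq_iv (t3 hp)

lemma substM_eq_iff (M : Matrix (Fin 3) (Fin 3) k) (q r : MvPolynomial (Fin 3) k) :
    substM M q = r ↔ ∀ x y z, act M (fun x y z => eval ![x, y, z] q) x y z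
      = eval ![x, y, z] r := by
  have hi : Infinite k := IsAlgClosed.instInfinite
  constructor
  · rintro rfl x y z
    rw [eval_substM]
  · intro h
    apply MvPolynomial.funext
    intro v
    rw [← vec3_eta v, eval_substM]
    exact h _ _ _

end StmtFive

/-- Classification of totally harmonic ternary quartic forms (`H(q) = 0`,
i.e. `SG q = 0`) over an algebraically closed field of characteristic `p ≥ 0`. -/
theorem stmt5 {k : Type*} [Field k] [IsAlgClosed k] (p : ℕ) [CharP k p]
    (q : MvPolynomial (Fin 3) k) (hq0 : q ≠ 0) (hq4 : q.IsHomogeneous 4) :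
    SG q = 0 ↔
      ∃ M : Matrix (Fin 3) (Fin 3) k, IsUnit M.det ∧
        ((∃ f : Fin 5 → k, Sinv f = 0 ∧
            substM M q = ∑ i : Fin 5, C (f i) * X 1 ^ (4 - (i : ℕ)) * X 2 ^ (i : ℕ)) ∨
         (substM M q = X 0 ^ 4 + X 1 ^ 3 * X 2 ∧ (p = 2 ∨ p = 3)) ∨
         (substM M q = X 0 * (X 0 ^ 2 * X 1 + X 2 ^ 3) ∧ p = 3) ∨
         (substM M q = X 0 ^ 4 + X 1 ^ 4 + X 2 ^ 4 ∧ p = 3)) := by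
  have hi : Infinite k := IsAlgClosed.instInfinite
  have e1 : SG q = 0 ↔ Good p (fun x y z => eval ![x, y, z] q) :=
    ⟨fun h => classify _ ⟨q, hq4, rfl⟩ (P_of_SG q hq4 h),
      fun h => SG_of_P q hq4 (Pq_of_Good h)⟩
  rw [e1, Good]
  have e2 : ∀ (f : Fin 5 → k) (x y z : k), eval ![x, y, z]
      (∑ i : Fin 5, C (f i) * X 1 ^ (4 - (i : ℕ)) * X 2 ^ (i : ℕ) : MvPolynomial (Fin 3) k)
      = bq f y z := by
    intro f x y z
    simp [Fin.sum_univ_five, bq]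
  simp only [isUnit_iff_ne_zero, substM_eq_iff, e2]
  simp
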